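/- For every positive integer N, for Lebesgue almost every x ∈ [0,1) with N-continued fraction coefficients (a_k), the geometric mean of the coefficients converges to the constant K_N: lim_{n→∞} (a_1 a_2 ⋯ a_n)^{1/n} = K_N = Π_{k=N}^∞ ((k+1)²/(k(k+2)))^{ln k/(ln(N+1) − ln N)}. -/

import Mathlib

open MeasureTheory Filter Set

/-- The generalized Gauss transformation `T_N(x) = {N/x}` (and `T_N(0) = 0`). -/
noncomputable def gaussT (N : ℕ) (x : ℝ) : ℝ :=
  if x = 0 then 0 else Int.fract ((N : ℝ) / x)

/-- The generalized Khinchin constant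
`K_N = ∏_{k=N}^∞ ((k+1)² / (k(k+2))) ^ (log k / (log (N+1) - log N))`
(the product is reindexed by `k = j + N`, `j : ℕ`). -/
noncomputable def khinchinConst (N : ℕ) : ℝ :=
  ∏' j : ℕ,
    ((((j : ℝ) + N + 1) ^ 2 / (((j : ℝ) + N) * ((j : ℝ) + N + 2))) ^
      (Real.log ((j : ℝ) + N) / (Real.log (N + 1) - Real.log N)))

section MaximalErgodic

variable {α : Type*} {T : α → α} {f : α → ℝ}

/-- The running maximum of the Birkhoff sums of `f` along `T` over at least one and at most
`n + 1` steps. -/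
def birkhoffMax (T : α → α) (f : α → ℝ) : ℕ → α → ℝ
  | 0 => f
  | n + 1 => fun x => f x + max 0 (birkhoffMax T f n (T x))

theorem birkhoffMax_succ (n : ℕ) (x : α) :
    birkhoffMax T f (n + 1) x = f x + max 0 (birkhoffMax T f n (T x)) := rfl

theorem birkhoffMax_le_succ (n : ℕ) (x : α) :
    birkhoffMax T f n x ≤ birkhoffMax T f (n + 1) x := by
  induction n generalizing x with
  | zero => simp [birkhoffMax]
  | succ n ih =>
    rw [birkhoffMax_succ, birkhoffMax_succ]
    gcongr
    exact ih _

theorem le_birkhoffMax (n : ℕ) (x : α) : f x ≤ birkhoffMax T f n x := by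
  cases n <;> simp [birkhoffMax]

theorem birkhoffSum_succ_le_birkhoffMax (n : ℕ) (x : α) :
    birkhoffSum T f (n + 1) x ≤ birkhoffMax T f n x := by
  induction n generalizing x with
  | zero => simp [birkhoffMax]
  | succ n ih =>
    rw [birkhoffSum_succ', birkhoffMax_succ]
    gcongr
    exact (ih _).trans (le_max_right _ _)

theorem unbounded_birkhoffMax_comp_iff (x : α) :
    (∀ C : ℕ, ∃ n, (C : ℝ) < birkhoffMax T f n (T x)) ↔
      ∀ C : ℕ, ∃ n, (C : ℝ) < birkhoffMax T f n x := by
  constructor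
  · intro h C
    obtain ⟨D, hD⟩ := exists_nat_gt (C - f x)
    obtain ⟨n, hn⟩ := h D
    refine ⟨n + 1, ?_⟩
    rw [birkhoffMax_succ]
    linarith [le_max_right 0 (birkhoffMax T f n (T x))]
  · intro h C
    obtain ⟨D, hD⟩ := exists_nat_gt (C + f x)
    obtain ⟨n, hn⟩ := h D
    refine ⟨n, ?_⟩
    have h1 := hn.trans_le (birkhoffMax_le_succ n x)
    rw [birkhoffMax_succ] at h1
    have h2 : (C : ℝ) < max 0 (birkhoffMax T f n (T x)) := by linarith
    exact (lt_max_iff.1 h2).resolve_left (not_lt.2 C.cast_nonneg)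

variable [MeasurableSpace α] {μ : Measure α}

theorem measurable_birkhoffMax (hT : Measurable T) (hf : Measurable f) (n : ℕ) :
    Measurable (birkhoffMax T f n) := by
  induction n with
  | zero => exact hf
  | succ n ih => exact hf.add (measurable_const.max (ih.comp hT))

theorem integrable_birkhoffMax (hT : MeasurePreserving T μ μ) (hf : Integrable f μ) (n : ℕ) :
    Integrable (birkhoffMax T f n) μ := by
  induction n with
  | zero => exact hf
  | succ n ih => exact hf.add ((hT.integrable_comp_of_integrable ih).pos_part.congr
      (.of_forall fun x => max_comm _ _))

/-- If the running maxima of the Birkhoff sums are almost surely unbounded, then the integral is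
nonnegative. -/
theorem integral_nonneg_of_unbounded_birkhoffMax (hT : MeasurePreserving T μ μ)
    (hf : Integrable f μ) (h : ∀ᵐ x ∂μ, ∀ C : ℕ, ∃ n, (C : ℝ) < birkhoffMax T f n x) :
    0 ≤ ∫ x, f x ∂μ := by
  have hlim : Tendsto (fun n => ∫ x, (birkhoffMax T f (n + 1) x - birkhoffMax T f n (T x)) ∂μ)
      atTop (nhds (∫ x, f x ∂μ)) := by
    refine tendsto_integral_of_dominated_convergence (fun x => |f x| + |f (T x)|) (fun n => ?_)
      (hf.abs.add (hT.integrable_comp_of_integrable hf).abs) (fun n => .of_forall fun x => ?_) ?_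
    · exact ((integrable_birkhoffMax hT hf (n + 1)).sub
        (hT.integrable_comp_of_integrable (integrable_birkhoffMax hT hf n))).aestronglyMeasurable
    · have h1 := le_birkhoffMax (T := T) (f := f) n (T x)
      have h2 : |max 0 (birkhoffMax T f n (T x)) - birkhoffMax T f n (T x)| ≤ |f (T x)| := by
        rcases max_cases 0 (birkhoffMax T f n (T x)) with ⟨h2, h3⟩ | ⟨h2, h3⟩ <;> rw [h2]
        · rw [zero_sub, abs_neg, abs_of_nonpos h3, abs_of_nonpos (h1.trans h3)]
          linarith
        · simp
      rw [birkhoffMax_succ, Real.norm_eq_abs, add_sub_assoc]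
      exact (abs_add_le _ _).trans (by gcongr)
    · filter_upwards [h] with x hx
      obtain ⟨n, hn⟩ := unbounded_birkhoffMax_comp_iff x |>.2 hx 0
      refine tendsto_const_nhds.congr' ?_
      filter_upwards [eventually_ge_atTop n] with m hm
      have h1 : 0 < birkhoffMax T f m (T x) := by
        have : birkhoffMax T f n (T x) ≤ birkhoffMax T f m (T x) :=
          monotone_nat_of_le_succ (f := fun k => birkhoffMax T f k (T x))
            (fun k => birkhoffMax_le_succ k (T x)) hm
        push_cast at hn
        linarith
      rw [birkhoffMax_succ, max_eq_right h1.le, add_sub_cancel_right]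
  refine ge_of_tendsto' hlim fun n => ?_
  have h1 : ∫ x, birkhoffMax T f n (T x) ∂μ = ∫ x, birkhoffMax T f n x ∂μ := by
    rw [← integral_map hT.measurable.aemeasurable, hT.map_eq]
    rw [hT.map_eq]
    exact (integrable_birkhoffMax hT hf n).aestronglyMeasurable
  have h2 : Integrable (fun x => birkhoffMax T f n (T x)) μ :=
    hT.integrable_comp_of_integrable (integrable_birkhoffMax hT hf n)
  rw [integral_sub (integrable_birkhoffMax hT hf (n + 1)) h2, h1, sub_nonneg]
  exact integral_mono (integrable_birkhoffMax hT hf n) (integrable_birkhoffMax hT hf (n + 1))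
    (birkhoffMax_le_succ n)

theorem Ergodic.ae_birkhoffSum_le_of_integral_neg [IsProbabilityMeasure μ] (hT : Ergodic T μ)
    (hfm : Measurable f) (hf : Integrable f μ) (hneg : ∫ x, f x ∂μ < 0) :
    ∀ᵐ x ∂μ, ∃ C : ℝ, ∀ n, birkhoffSum T f n x ≤ C := by
  set A : Set α := {x | ∀ C : ℕ, ∃ n, (C : ℝ) < birkhoffMax T f n x} with hA
  have hAm : MeasurableSet A := by
    rw [hA]
    simp only [ofPred_forall, ofPred_exists]
    exact .iInter fun C => .iUnion fun n =>
      measurableSet_lt measurable_const (measurable_birkhoffMax hT.measurable hfm n)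
  rcases hT.toPreErgodic.ae_mem_or_ae_notMem hAm
    (Set.ext fun x => unbounded_birkhoffMax_comp_iff x) with h | h
  · exact absurd (integral_nonneg_of_unbounded_birkhoffMax hT.toMeasurePreserving hf h)
      (not_le.2 hneg)
  · filter_upwards [h] with x hx
    simp only [hA, mem_ofPred_eq, not_forall, not_exists, not_lt] at hx
    obtain ⟨C, hC⟩ := hx
    refine ⟨C, fun n => ?_⟩
    cases n with
    | zero => simp
    | succ n => exact (birkhoffSum_succ_le_birkhoffMax n x).trans (hC n)

theorem Ergodic.ae_eventually_birkhoffAverage_lt [IsProbabilityMeasure μ] (hT : Ergodic T μ)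
    (hfm : Measurable f) (hf : Integrable f μ) :
    ∀ᵐ x ∂μ, ∀ b > ∫ x, f x ∂μ, ∀ᶠ n in atTop, birkhoffAverage ℝ T f n x < b := by
  have key : ∀ᵐ x ∂μ, ∀ m : ℕ, ∃ C : ℝ, ∀ n,
      birkhoffSum T (fun x => f x - (∫ x, f x ∂μ + 1 / (m + 1))) n x ≤ C := by
    refine ae_all_iff.2 fun m => hT.ae_birkhoffSum_le_of_integral_neg (hfm.sub measurable_const)
      (hf.sub (integrable_const _)) ?_
    rw [integral_sub hf (integrable_const _)]
    simp only [integral_const, probReal_univ, one_smul]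
    have : (0 : ℝ) < 1 / (m + 1) := by positivity
    linarith
  filter_upwards [key] with x hx b hb
  obtain ⟨m, hm⟩ := exists_nat_one_div_lt (sub_pos.2 hb)
  obtain ⟨C, hC⟩ := hx m
  have hlim : Tendsto (fun n : ℕ => ∫ x, f x ∂μ + 1 / (m + 1) + C / n) atTop
      (nhds (∫ x, f x ∂μ + 1 / (m + 1) + 0)) :=
    tendsto_const_nhds.add (tendsto_const_div_atTop_nhds_zero_nat C)
  filter_upwards [hlim.eventually_lt_const (show _ < b by linarith), eventually_gt_atTop 0]
    with n hn h0
  refine lt_of_le_of_lt ?_ hn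
  have h0' : (0 : ℝ) < n := by exact_mod_cast h0
  have h1 := hC n
  simp only [birkhoffSum, Finset.sum_sub_distrib, Finset.sum_const, Finset.card_range,
    nsmul_eq_mul] at h1
  rw [birkhoffAverage, birkhoffSum, smul_eq_mul, inv_mul_le_iff₀ h0']
  field_simp at h1 ⊢
  linarith

/-- Birkhoff's pointwise ergodic theorem for ergodic transformations. -/
theorem Ergodic.ae_tendsto_birkhoffAverage [IsProbabilityMeasure μ] (hT : Ergodic T μ)
    (hfm : Measurable f) (hf : Integrable f μ) :
    ∀ᵐ x ∂μ, Tendsto (fun n => birkhoffAverage ℝ T f n x) atTop (nhds (∫ x, f x ∂μ)) := by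
  filter_upwards [hT.ae_eventually_birkhoffAverage_lt hfm hf,
    hT.ae_eventually_birkhoffAverage_lt hfm.neg hf.neg] with x h1 h2
  refine tendsto_order.2 ⟨fun a ha => ?_, h1⟩
  have h3 := h2 (-a) (by simpa [integral_neg] using ha)
  filter_upwards [h3] with n hn
  simp only [birkhoffAverage, birkhoffSum, Pi.neg_apply, Finset.sum_neg_distrib, smul_neg] at hn ⊢
  linarith

end MaximalErgodic

section GaussMap

open scoped ENNReal

variable {N : ℕ}

theorem floor_div_inverse_branch (hN : 0 < N) (j : ℕ) {x : ℝ} (hx : x ∈ Ico (0 : ℝ) 1) :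
    ⌊(N : ℝ) / (N / (j + N + x))⌋ = j + N := by
  have hN' : (N : ℝ) ≠ 0 := by positivity
  rw [div_div_cancel₀ hN', Int.floor_eq_iff]
  push_cast
  constructor <;> linarith [hx.1, hx.2]

theorem gaussT_inverse_branch (hN : 0 < N) (j : ℕ) {x : ℝ} (hx : x ∈ Ico (0 : ℝ) 1) :
    gaussT N (N / (j + N + x)) = x := by
  have hN' : (0 : ℝ) < N := by exact_mod_cast hN
  have hpos : 0 < j + N + x := by have := hx.1; positivity
  rw [gaussT, if_neg (by positivity), Int.fract, floor_div_inverse_branch hN j hx,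
    div_div_cancel₀ hN'.ne']
  push_cast
  ring

theorem measurable_gaussT : Measurable (gaussT N) :=
  .ite (measurableSet_singleton 0) measurable_const
    (measurable_fract.comp (measurable_const.div measurable_id))

theorem image_inverse_branch (hN : 0 < N) (j : ℕ) :
    (fun x : ℝ => (N : ℝ) / (j + N + x)) '' Ico 0 1 =
      Ioc ((N : ℝ) / ((j + 1 : ℕ) + N)) (N / (j + N)) := by
  have hN' : (0 : ℝ) < N := by exact_mod_cast hN
  ext y
  constructor
  · rintro ⟨x, ⟨h0, h1⟩, rfl⟩
    push_cast
    constructor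
    · apply div_lt_div_of_pos_left hN' (by positivity)
      linarith
    · apply div_le_div_of_nonneg_left hN'.le (by positivity)
      linarith
  · rintro ⟨h0, h1⟩
    push_cast at h0
    have hy : 0 < y := lt_trans (by positivity) h0
    rw [div_lt_iff₀ (by positivity)] at h0
    rw [le_div_iff₀ (by positivity)] at h1
    refine ⟨N / y - (j + N), ⟨?_, ?_⟩, ?_⟩
    · rw [sub_nonneg, le_div_iff₀ hy]
      linarith
    · rw [sub_lt_iff_lt_add, div_lt_iff₀ hy]
      linarith
    · simp only [add_sub_cancel]
      exact div_div_cancel₀ hN'.ne'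

theorem iUnion_image_inverse_branch (hN : 0 < N) :
    ⋃ j : ℕ, Ioc ((N : ℝ) / ((j + 1 : ℕ) + N)) (N / (j + N)) = Ioc 0 1 := by
  have hN' : (0 : ℝ) < N := by exact_mod_cast hN
  ext y
  simp only [mem_iUnion, mem_Ioc]
  constructor
  · rintro ⟨j, h0, h1⟩
    refine ⟨lt_trans (by positivity) h0, h1.trans ?_⟩
    rw [div_le_one (by positivity)]
    simp
  · rintro ⟨h0, h1⟩
    have h2 : (N : ℝ) ≤ N / y := by
      rw [le_div_iff₀ h0]
      nlinarith
    obtain ⟨j, hj⟩ := Nat.exists_eq_add_of_le' (Nat.le_floor h2)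
    have h3 := Nat.floor_le (hN'.le.trans h2)
    have h4 := Nat.lt_floor_add_one (N / y : ℝ)
    rw [hj] at h3 h4
    push_cast at h3 h4 ⊢
    rw [le_div_iff₀ h0] at h3
    rw [div_lt_iff₀ h0] at h4
    refine ⟨j, ?_, ?_⟩
    · rw [div_lt_iff₀ (by positivity)]
      linarith
    · rw [le_div_iff₀ (by positivity)]
      linarith

/-- Change of variables along the inverse branches `x ↦ N / (k + x)`, `k ≥ N`, of `gaussT N`. -/
theorem lintegral_eq_tsum_inverse_branch (hN : 0 < N) (F : ℝ → ℝ≥0∞) :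
    ∫⁻ x in Ico (0 : ℝ) 1, F x =
      ∑' j : ℕ, ∫⁻ x in Ico (0 : ℝ) 1,
        ENNReal.ofReal (N / (j + N + x) ^ 2) * F (N / (j + N + x)) := by
  have hN' : (0 : ℝ) < N := by exact_mod_cast hN
  have hanti : Antitone fun j : ℕ => (N : ℝ) / (j + N) := fun i j hij => by
    have : (i : ℝ) ≤ j := by exact_mod_cast hij
    simp only
    gcongr
  have hdisj : Pairwise (Function.onFun Disjoint
      fun j : ℕ => Ioc ((N : ℝ) / ((j + 1 : ℕ) + N)) (N / (j + N))) :=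
    hanti.pairwise_disjoint_on_Ioc_succ
  conv_lhs => rw [restrict_Ico_eq_restrict_Ioc, ← iUnion_image_inverse_branch hN, lintegral_iUnion
    (fun _ => measurableSet_Ioc) hdisj]
  · refine tsum_congr fun j => ?_
    rw [← image_inverse_branch hN, lintegral_image_eq_lintegral_abs_deriv_mul measurableSet_Ico
      (f' := fun x : ℝ => -(N / (j + N + x) ^ 2))]
    · simp_rw [abs_neg]
      refine lintegral_congr fun x => ?_
      rw [abs_of_nonneg (by positivity)]
    · intro x hx
      have hpos : j + N + x ≠ 0 := by have := hx.1; positivity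
      have := ((hasDerivAt_id x).const_add (j + N : ℝ)).fun_inv hpos |>.const_mul (N : ℝ)
      refine (this.congr_deriv ?_).hasDerivWithinAt.congr_of_eventuallyEq ?_ ?_
      · simp only [id]
        ring
      · exact .of_forall fun y => div_eq_mul_inv _ _
      · exact div_eq_mul_inv _ _
    · intro x hx y hy hxy
      have h := congrArg (gaussT N) hxy
      simpa only [gaussT_inverse_branch hN j hx, gaussT_inverse_branch hN j hy] using h

theorem abs_sub_inverse_branch_le (hN : 0 < N) (j : ℕ) {x y : ℝ} (hx : x ∈ Icc (0 : ℝ) 1)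
    (hy : y ∈ Icc (0 : ℝ) 1) :
    |1 / (1 + (N : ℝ) / (j + N + x)) - 1 / (1 + (N : ℝ) / (j + N + y))| ≤
      |1 / (1 + x) - 1 / (1 + y)| / 2 := by
  have hN' : (1 : ℝ) ≤ N := by exact_mod_cast hN
  obtain ⟨hx0, hx1⟩ := hx
  obtain ⟨hy0, hy1⟩ := hy
  have h1 : 1 / (1 + (N : ℝ) / (j + N + x)) - 1 / (1 + (N : ℝ) / (j + N + y)) =
      -(N / ((j + 2 * N + x) * (j + 2 * N + y))) * (y - x) := by
    field_simp
    ring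
  have h2 : 1 / (1 + x) - 1 / (1 + y) = 1 / ((1 + x) * (1 + y)) * (y - x) := by
    field_simp
    ring
  rw [h1, h2, abs_mul, abs_mul, abs_neg,
    abs_of_nonneg (show (0 : ℝ) ≤ N / ((j + 2 * N + x) * (j + 2 * N + y)) by positivity),
    abs_of_nonneg (show (0 : ℝ) ≤ 1 / ((1 + x) * (1 + y)) by positivity), mul_div_right_comm]
  refine mul_le_mul_of_nonneg_right ?_ (abs_nonneg _)
  rw [div_div, div_le_div_iff₀ (by positivity) (by positivity)]
  have hj : (0 : ℝ) ≤ j := j.cast_nonneg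
  have h3 : (2 * N + x) * (2 * N + y) ≤ (j + 2 * N + x) * (j + 2 * N + y) := by
    gcongr <;> linarith
  have h4 : x * y ≤ 1 := by nlinarith
  nlinarith [mul_nonneg hx0 hy0]

theorem weight_inverse_branch (hN : 0 < N) (j : ℕ) {t x : ℝ} (ht : 0 ≤ t) (hx : 0 ≤ x) :
    (N : ℝ) / (j + N + x) ^ 2 * (1 / (1 + t * (N / (j + N + x))) ^ 2) =
      N / (j + N + t * N) ^ 2 * (1 / (1 + 1 / (j + N + t * N) * x) ^ 2) := by
  have hN' : (0 : ℝ) < N := by exact_mod_cast hN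
  have h1 : 0 < j + N + t * N := by positivity
  field_simp
  ring

/-- A quantitative mixing estimate: an invariant set meets every small interval in a proportion
bounded below by its measure. -/
theorem volume_mul_lintegral_le_of_invariant (hN : 0 < N) {A : Set ℝ} (hA : MeasurableSet A)
    (hinv : gaussT N ⁻¹' A = A) (n : ℕ) {t K : ℝ} (ht : t ∈ Icc (0 : ℝ) 1) (hK : 0 ≤ K)
    {g : ℝ → ℝ≥0∞} (hg : Measurable g)
    (hgK : ∀ x ∈ Icc (0 : ℝ) 1, ∀ y ∈ Icc (0 : ℝ) 1,
      g x ≤ g y + ENNReal.ofReal (K * |1 / (1 + x) - 1 / (1 + y)|)) :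
    volume.restrict (Ico (0 : ℝ) 1) A *
        ∫⁻ x in Ico (0 : ℝ) 1, ENNReal.ofReal (1 / (1 + t * x) ^ 2) * g x ≤
      4 * (∫⁻ x in Ico (0 : ℝ) 1,
          ENNReal.ofReal (1 / (1 + t * x) ^ 2) * (A.indicator 1 x * g x)) +
        ENNReal.ofReal (K / 2 ^ n) *
          ∫⁻ x in Ico (0 : ℝ) 1, ENNReal.ofReal (1 / (1 + t * x) ^ 2) := by
  induction n generalizing t K g with
  | zero =>
    set m : ℝ≥0∞ := ⨅ y : Icc (0 : ℝ) 1, g y with hm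
    have hw : Measurable fun x : ℝ => ENNReal.ofReal (1 / (1 + t * x) ^ 2) := by fun_prop
    have hind : Measurable (A.indicator (1 : ℝ → ℝ≥0∞)) := measurable_one.indicator hA
    have hupper : ∀ x ∈ Icc (0 : ℝ) 1, g x ≤ m + ENNReal.ofReal K := by
      intro x hx
      rw [hm, ENNReal.iInf_add]
      refine le_iInf fun ⟨y, hy⟩ => (hgK x hx y hy).trans ?_
      gcongr
      refine mul_le_of_le_one_right hK ?_
      have bd : ∀ z ∈ Icc (0 : ℝ) 1, 0 ≤ 1 / (1 + z) ∧ 1 / (1 + z) ≤ 1 := fun z hz => by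
        have := hz.1
        exact ⟨by positivity, by rw [div_le_one (by positivity)]; linarith⟩
      rw [abs_le]
      constructor <;> linarith [(bd x hx).1, (bd x hx).2, (bd y hy).1, (bd y hy).2]
    have hlower : ∀ x ∈ Ico (0 : ℝ) 1, (1 : ℝ≥0∞) ≤ 4 * ENNReal.ofReal (1 / (1 + t * x) ^ 2) := by
      intro x hx
      have h1 : t * x ≤ 1 := mul_le_one₀ ht.2 hx.1 hx.2.le
      have h0 : 0 ≤ t * x := mul_nonneg ht.1 hx.1
      rw [show (4 : ℝ≥0∞) = ENNReal.ofReal 4 by norm_num, ← ENNReal.ofReal_mul (by norm_num),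
        ENNReal.one_le_ofReal, mul_one_div, le_div_iff₀ (by positivity)]
      nlinarith
    have hwle : ∀ x ∈ Ico (0 : ℝ) 1, ENNReal.ofReal (1 / (1 + t * x) ^ 2) ≤ 1 := by
      intro x hx
      have h0 : 0 ≤ t * x := mul_nonneg ht.1 hx.1
      rw [ENNReal.ofReal_le_one, div_le_one (by positivity)]
      nlinarith
    have hA1 : volume.restrict (Ico (0 : ℝ) 1) A ≤ 1 := by
      refine (measure_mono (subset_univ _)).trans ?_
      simp
    set W := ∫⁻ x in Ico (0 : ℝ) 1, ENNReal.ofReal (1 / (1 + t * x) ^ 2) with hW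
    have hW1 : W ≤ 1 := by
      calc W ≤ ∫⁻ x in Ico (0 : ℝ) 1, 1 := setLIntegral_mono measurable_const hwle
        _ = 1 := by simp
    have h1 : ∫⁻ x in Ico (0 : ℝ) 1, ENNReal.ofReal (1 / (1 + t * x) ^ 2) * g x ≤
        W * (m + ENNReal.ofReal K) := by
      rw [hW, ← lintegral_mul_const _ hw]
      refine setLIntegral_mono (by fun_prop) fun x hx => ?_
      gcongr
      exact hupper x (Ico_subset_Icc_self hx)
    have h2 : volume.restrict (Ico (0 : ℝ) 1) A * m ≤ 4 * ∫⁻ x in Ico (0 : ℝ) 1,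
          ENNReal.ofReal (1 / (1 + t * x) ^ 2) * (A.indicator 1 x * g x) := by
      rw [← lintegral_indicator_one hA, ← lintegral_mul_const _ hind,
        ← lintegral_const_mul _ (by fun_prop)]
      refine setLIntegral_mono (by fun_prop) fun x hx => ?_
      calc A.indicator 1 x * m ≤ A.indicator 1 x * g x := by
            gcongr
            exact iInf_le (fun y : Icc (0 : ℝ) 1 => g y) ⟨x, Ico_subset_Icc_self hx⟩
        _ = 1 * (A.indicator 1 x * g x) := (one_mul _).symm
        _ ≤ 4 * ENNReal.ofReal (1 / (1 + t * x) ^ 2) * (A.indicator 1 x * g x) := by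
            gcongr
            exact hlower x hx
        _ = _ := mul_assoc _ _ _
    calc volume.restrict (Ico (0 : ℝ) 1) A *
        ∫⁻ x in Ico (0 : ℝ) 1, ENNReal.ofReal (1 / (1 + t * x) ^ 2) * g x
        ≤ volume.restrict (Ico (0 : ℝ) 1) A * (W * (m + ENNReal.ofReal K)) := by gcongr
      _ = volume.restrict (Ico (0 : ℝ) 1) A * m * W +
          volume.restrict (Ico (0 : ℝ) 1) A * (ENNReal.ofReal K * W) := by ring
      _ ≤ volume.restrict (Ico (0 : ℝ) 1) A * m * 1 + 1 * (ENNReal.ofReal K * W) := by gcongr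
      _ ≤ _ := by
          rw [mul_one, one_mul, pow_zero, div_one]
          gcongr
  | succ n ih =>
    have key : ∀ G : ℝ → ℝ≥0∞, Measurable G →
        ∫⁻ x in Ico (0 : ℝ) 1, ENNReal.ofReal (1 / (1 + t * x) ^ 2) * G x =
        ∑' j : ℕ, ENNReal.ofReal (N / (j + N + t * N) ^ 2) * ∫⁻ x in Ico (0 : ℝ) 1,
          ENNReal.ofReal (1 / (1 + 1 / (j + N + t * N) * x) ^ 2) * G (N / (j + N + x)) := by
      intro G hG
      rw [lintegral_eq_tsum_inverse_branch hN]
      refine tsum_congr fun j => ?_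
      rw [← lintegral_const_mul _ (by fun_prop)]
      refine setLIntegral_congr_fun measurableSet_Ico fun x hx => ?_
      rw [← mul_assoc, ← mul_assoc, ← ENNReal.ofReal_mul (by positivity),
        ← ENNReal.ofReal_mul (by positivity), weight_inverse_branch hN j ht.1 hx.1]
    have hind : Measurable (A.indicator (1 : ℝ → ℝ≥0∞)) := measurable_one.indicator hA
    have h1 := key g hg
    have h2 := key (fun x => A.indicator 1 x * g x) (by fun_prop)
    have h3 := key 1 measurable_one
    simp only [Pi.one_apply, mul_one] at h3
    rw [h1, h2, h3, ← ENNReal.tsum_mul_left, ← ENNReal.tsum_mul_left, ← ENNReal.tsum_mul_left,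
      ← ENNReal.tsum_add]
    refine ENNReal.tsum_le_tsum fun j => ?_
    have hN' : (1 : ℝ) ≤ N := by exact_mod_cast hN
    have hs : 1 / (j + N + t * N : ℝ) ∈ Icc (0 : ℝ) 1 := by
      have := ht.1
      have htN : 0 ≤ t * N := by positivity
      refine ⟨by positivity, ?_⟩
      rw [div_le_one (by positivity)]
      linarith [(j.cast_nonneg : (0 : ℝ) ≤ j)]
    have hmem : ∀ x ∈ Icc (0 : ℝ) 1, (N / (j + N + x) : ℝ) ∈ Icc (0 : ℝ) 1 := by
      intro x hx
      have := hx.1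
      refine ⟨by positivity, ?_⟩
      rw [div_le_one (by positivity)]
      linarith [(j.cast_nonneg : (0 : ℝ) ≤ j)]
    have h4 := ih hs (K := K / 2) (by positivity) (g := fun x => g (N / (j + N + x)))
      (by fun_prop) fun x hx y hy => by
        refine (hgK _ (hmem x hx) _ (hmem y hy)).trans ?_
        refine add_le_add_right (ENNReal.ofReal_le_ofReal ?_) _
        calc K * _ ≤ K * (|1 / (1 + x) - 1 / (1 + y)| / 2) :=
              mul_le_mul_of_nonneg_left (abs_sub_inverse_branch_le hN j hx hy) hK
          _ = _ := by ring
    rw [div_div, ← pow_succ'] at h4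
    have h5 : ∀ x ∈ Ico (0 : ℝ) 1, A.indicator (1 : ℝ → ℝ≥0∞) (N / (j + N + x)) =
        A.indicator 1 x := by
      intro x hx
      have : (N / (j + N + x) : ℝ) ∈ A ↔ x ∈ A := by
        conv_lhs => rw [← hinv]
        rw [mem_preimage, gaussT_inverse_branch hN j hx]
      by_cases hxA : x ∈ A
      · rw [indicator_of_mem hxA, indicator_of_mem (this.2 hxA), Pi.one_apply, Pi.one_apply]
      · rw [indicator_of_notMem hxA, indicator_of_notMem (mt this.1 hxA)]
    have h6 : ∫⁻ x in Ico (0 : ℝ) 1, ENNReal.ofReal (1 / (1 + 1 / (j + N + t * N) * x) ^ 2) *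
          (A.indicator 1 (N / (j + N + x)) * g (N / (j + N + x))) =
        ∫⁻ x in Ico (0 : ℝ) 1, ENNReal.ofReal (1 / (1 + 1 / (j + N + t * N) * x) ^ 2) *
          (A.indicator 1 x * g (N / (j + N + x))) :=
      setLIntegral_congr_fun measurableSet_Ico fun x hx => by simp only [h5 x hx]
    rw [h6]
    refine (mul_left_comm _ _ _).trans_le ((mul_le_mul_right h4 _).trans_eq ?_)
    rw [mul_add, mul_left_comm, mul_left_comm _ (ENNReal.ofReal (K / _))]

theorem abs_sub_le_four_mul_abs_inv_sub {x y : ℝ} (hx : x ∈ Icc (0 : ℝ) 1)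
    (hy : y ∈ Icc (0 : ℝ) 1) : |x - y| ≤ 4 * |1 / (1 + x) - 1 / (1 + y)| := by
  obtain ⟨hx0, hx1⟩ := hx
  obtain ⟨hy0, hy1⟩ := hy
  have h1 : 1 / (1 + x) - 1 / (1 + y) = 1 / ((1 + x) * (1 + y)) * -(x - y) := by
    field_simp
    ring
  rw [h1, abs_mul, abs_neg,
    abs_of_nonneg (show (0 : ℝ) ≤ 1 / ((1 + x) * (1 + y)) by positivity), ← mul_assoc]
  refine le_mul_of_one_le_left (abs_nonneg _) ?_
  rw [mul_one_div, le_div_iff₀ (by positivity)]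
  nlinarith

theorem volume_mul_lintegral_lipschitz_le_of_invariant (hN : 0 < N) {A : Set ℝ}
    (hA : MeasurableSet A) (hinv : gaussT N ⁻¹' A = A) {K : NNReal} {g : ℝ → NNReal}
    (hg : LipschitzWith K g) :
    volume.restrict (Ico (0 : ℝ) 1) A * ∫⁻ x in Ico (0 : ℝ) 1, g x ≤
      4 * ∫⁻ x in Ico (0 : ℝ) 1, A.indicator 1 x * g x := by
  have h1 := fun n => volume_mul_lintegral_le_of_invariant hN hA hinv n (t := 0) (by simp)
    (K := 4 * K) (by positivity) (g := fun x => (g x : ℝ≥0∞))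
    (measurable_coe_nnreal_ennreal.comp hg.continuous.measurable) fun x hx y hy => by
      rw [← ENNReal.ofReal_coe_nnreal, ← ENNReal.ofReal_coe_nnreal,
        ← ENNReal.ofReal_add (by positivity) (by positivity)]
      refine ENNReal.ofReal_le_ofReal ?_
      have h2 := hg.dist_le_mul x y
      rw [NNReal.dist_eq, Real.dist_eq] at h2
      have h3 := mul_le_mul_of_nonneg_left (abs_sub_le_four_mul_abs_inv_sub hx hy) K.coe_nonneg
      linarith [le_abs_self ((g x : ℝ) - g y)]
  simp only [zero_mul, add_zero, one_pow, div_one, ENNReal.ofReal_one, one_mul, lintegral_one,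
    Measure.restrict_apply_univ, Real.volume_Ico, sub_zero, mul_one] at h1
  have h2 : Tendsto (fun n : ℕ => (4 * ∫⁻ x in Ico (0 : ℝ) 1, A.indicator 1 x * (g x : ℝ≥0∞)) +
      ENNReal.ofReal (4 * K / 2 ^ n)) atTop
      (nhds ((4 * ∫⁻ x in Ico (0 : ℝ) 1, A.indicator 1 x * (g x : ℝ≥0∞)) + 0)) := by
    refine tendsto_const_nhds.add ?_
    rw [← ENNReal.ofReal_zero]
    refine ENNReal.tendsto_ofReal ?_
    exact tendsto_const_nhds.div_atTop (tendsto_pow_atTop_atTop_of_one_lt (by norm_num))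
  rw [add_zero] at h2
  exact ge_of_tendsto' h2 h1

theorem volume_mul_volume_closed_le_of_invariant (hN : 0 < N) {A F : Set ℝ}
    (hA : MeasurableSet A) (hinv : gaussT N ⁻¹' A = A) (hF : IsClosed F) :
    volume.restrict (Ico (0 : ℝ) 1) A * volume.restrict (Ico (0 : ℝ) 1) F ≤
      4 * (volume.restrict (Ico (0 : ℝ) 1)).restrict A F := by
  have hpos : ∀ n : ℕ, (0 : ℝ) < 1 / (n + 1) := fun n => by positivity
  have h1 := tendsto_lintegral_thickenedIndicator_of_isClosed
    (volume.restrict (Ico (0 : ℝ) 1)) hF hpos tendsto_one_div_add_atTop_nhds_zero_nat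
  have h2 := tendsto_lintegral_thickenedIndicator_of_isClosed
    ((volume.restrict (Ico (0 : ℝ) 1)).restrict A) hF hpos tendsto_one_div_add_atTop_nhds_zero_nat
  refine le_of_tendsto_of_tendsto'
    (ENNReal.Tendsto.const_mul h1 (.inr (measure_ne_top _ _)))
    (ENNReal.Tendsto.const_mul h2 (.inr (by norm_num))) fun n => ?_
  refine (volume_mul_lintegral_lipschitz_le_of_invariant hN hA hinv
    (lipschitzWith_thickenedIndicator (hpos n) F)).trans_eq ?_
  rw [← lintegral_indicator hA]
  congr 2 with x
  by_cases hx : x ∈ A <;> simp [hx]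

theorem preErgodic_gaussT (hN : 0 < N) :
    PreErgodic (gaussT N) (volume.restrict (Ico (0 : ℝ) 1)) where
  aeconst_set A hA hinv := by
    rw [eventuallyConst_set']
    by_cases h : volume.restrict (Ico (0 : ℝ) 1) A = 0
    · exact .inl (ae_eq_empty.2 h)
    · refine .inr (ae_eq_univ.2 ?_)
      rw [hA.compl.measure_eq_iSup_isClosed_of_ne_top (measure_ne_top _ _)]
      simp only [ENNReal.iSup_eq_zero]
      intro F hFA hF
      have h1 := volume_mul_volume_closed_le_of_invariant hN hA hinv hF
      have h2 : (volume.restrict (Ico (0 : ℝ) 1)).restrict A F = 0 := by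
        rw [Measure.restrict_apply hF.measurableSet,
          (disjoint_compl_left.mono_left hFA).inter_eq, measure_empty]
      rw [h2, mul_zero] at h1
      exact (mul_eq_zero.1 (le_antisymm h1 zero_le)).resolve_left h

/-- The invariant density of `gaussT N`. -/
noncomputable def gaussDensity (N : ℕ) (x : ℝ) : ℝ :=
  1 / (N + x) / (Real.log (N + 1) - Real.log N)

/-- The invariant probability measure of `gaussT N`. -/
noncomputable def gaussMeasure (N : ℕ) : Measure ℝ :=
  (volume.restrict (Ico (0 : ℝ) 1)).withDensity fun x => ENNReal.ofReal (gaussDensity N x)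

theorem measurable_gaussDensity : Measurable (gaussDensity N) := by
  unfold gaussDensity
  fun_prop

theorem log_add_one_sub_log_pos (hN : 0 < N) : 0 < Real.log (N + 1) - Real.log N := by
  have hN' : (0 : ℝ) < N := by exact_mod_cast hN
  exact sub_pos.2 (Real.log_lt_log hN' (by linarith))

theorem gaussDensity_pos (hN : 0 < N) {x : ℝ} (hx : x ∈ Ico (0 : ℝ) 1) : 0 < gaussDensity N x := by
  have := hx.1
  have := log_add_one_sub_log_pos hN
  rw [gaussDensity]
  positivity

theorem lintegral_gaussMeasure (f : ℝ → ℝ≥0∞) (hf : Measurable f) :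
    ∫⁻ x, f x ∂gaussMeasure N =
      ∫⁻ x in Ico (0 : ℝ) 1, ENNReal.ofReal (gaussDensity N x) * f x :=
  lintegral_withDensity_eq_lintegral_mul _ measurable_gaussDensity.ennreal_ofReal hf

theorem lintegral_gaussMeasure_eq_tsum (hN : 0 < N) (f : ℝ → ℝ≥0∞) (hf : Measurable f) :
    ∫⁻ x, f x ∂gaussMeasure N = ∑' j : ℕ, ∫⁻ x in Ico (0 : ℝ) 1,
      ENNReal.ofReal ((1 / (j + N + x) - 1 / (j + N + 1 + x)) /
        (Real.log (N + 1) - Real.log N)) * f (N / (j + N + x)) := by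
  rw [lintegral_gaussMeasure f hf, lintegral_eq_tsum_inverse_branch hN]
  refine tsum_congr fun j => setLIntegral_congr_fun measurableSet_Ico fun x hx => ?_
  rw [← mul_assoc, ← ENNReal.ofReal_mul (by positivity), gaussDensity]
  congr 2
  have hN' : (0 : ℝ) < N := by exact_mod_cast hN
  have hx0 := hx.1
  have h1 := (log_add_one_sub_log_pos hN).ne'
  have h2 : (N : ℝ) + N / (j + N + x) ≠ 0 := by positivity
  field_simp
  ring

theorem tsum_ofReal_telescope (hN : 0 < N) {x : ℝ} (hx : 0 ≤ x) {L : ℝ} (hL : 0 < L) :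
    ∑' j : ℕ, ENNReal.ofReal ((1 / (j + N + x) - 1 / (j + N + 1 + x)) / L) =
      ENNReal.ofReal (1 / (N + x) / L) := by
  have hN' : (0 : ℝ) < N := by exact_mod_cast hN
  have hnn : ∀ j : ℕ, 0 ≤ (1 / (j + N + x) - 1 / (j + N + 1 + x)) / L := fun j => by
    refine div_nonneg (sub_nonneg.2 ?_) hL.le
    exact one_div_le_one_div_of_le (by positivity) (by linarith)
  have hsum : HasSum (fun j : ℕ => (1 / (j + N + x) - 1 / (j + N + 1 + x)) / L)
      (1 / (N + x) / L) := by
    refine HasSum.div_const ?_ L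
    rw [hasSum_iff_tendsto_nat_of_nonneg fun j => by
      simpa using (div_le_div_iff_of_pos_right hL).1 ((zero_div L).trans_le (hnn j))]
    have h1 : ∀ n : ℕ, ∑ j ∈ Finset.range n, (1 / (j + N + x) - 1 / (j + N + 1 + x)) =
        1 / (N + x) - 1 / (n + (N + x)) := fun n => by
      have := Finset.sum_range_sub' (fun j : ℕ => 1 / (j + N + x : ℝ)) n
      simp only [Nat.cast_zero, zero_add, Nat.cast_add, Nat.cast_one] at this
      rw [← add_assoc, ← this]
      refine Finset.sum_congr rfl fun j _ => ?_
      ring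
    simp only [h1]
    have h2 : Tendsto (fun n : ℕ => 1 / (n + (N + x) : ℝ)) atTop (nhds 0) :=
      tendsto_const_nhds.div_atTop
        (tendsto_natCast_atTop_atTop.atTop_add tendsto_const_nhds)
    simpa using tendsto_const_nhds.sub h2
  rw [← ENNReal.ofReal_tsum_of_nonneg hnn hsum.summable, hsum.tsum_eq]

theorem measurePreserving_gaussT (hN : 0 < N) :
    MeasurePreserving (gaussT N) (gaussMeasure N) (gaussMeasure N) := by
  refine ⟨measurable_gaussT, Measure.ext fun s hs => ?_⟩
  have hind : Measurable (s.indicator (1 : ℝ → ℝ≥0∞)) := measurable_one.indicator hs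
  rw [← lintegral_indicator_one hs, ← lintegral_indicator_one hs,
    lintegral_map hind measurable_gaussT,
    lintegral_gaussMeasure_eq_tsum hN (fun x => s.indicator 1 (gaussT N x))
      (hind.comp measurable_gaussT),
    lintegral_gaussMeasure _ hind, ← lintegral_tsum]
  · refine setLIntegral_congr_fun measurableSet_Ico fun x hx => ?_
    simp only [gaussT_inverse_branch hN _ hx, ENNReal.tsum_mul_right]
    rw [tsum_ofReal_telescope hN hx.1 (log_add_one_sub_log_pos hN), gaussDensity]
  · have := measurable_gaussT (N := N)
    fun_prop

theorem integrableOn_one_div_add_and_integral {c : ℝ} (hc : 0 < c) :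
    IntegrableOn (fun x : ℝ => 1 / (c + x)) (Ico 0 1) ∧
      ∫ x in Ico (0 : ℝ) 1, 1 / (c + x) = Real.log (c + 1) - Real.log c := by
  constructor
  · refine (ContinuousOn.integrableOn_Icc ?_).mono_set Ico_subset_Icc_self
    refine continuousOn_const.div (by fun_prop) fun x hx => ?_
    have := hx.1
    positivity
  · rw [restrict_Ico_eq_restrict_Ioc, ← intervalIntegral.integral_of_le zero_le_one]
    have := intervalIntegral.integral_comp_add_left (a := 0) (b := 1) (fun x : ℝ => 1 / x) c
    rw [this, add_zero, integral_one_div_of_pos hc (by linarith),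
      Real.log_div (by positivity) hc.ne']

theorem isProbabilityMeasure_gaussMeasure (hN : 0 < N) :
    IsProbabilityMeasure (gaussMeasure N) := by
  have hN' : (0 : ℝ) < N := by exact_mod_cast hN
  obtain ⟨h1, h2⟩ := integrableOn_one_div_add_and_integral hN'
  have h3 : IntegrableOn (gaussDensity N) (Ico 0 1) := h1.div_const _
  refine ⟨?_⟩
  rw [gaussMeasure, withDensity_apply _ .univ, Measure.restrict_univ,
    ← ofReal_integral_eq_lintegral_ofReal h3
      ((ae_restrict_iff' measurableSet_Ico).2 (.of_forall fun x hx => (gaussDensity_pos hN hx).le))]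
  simp only [gaussDensity]
  rw [integral_div, h2, div_self (log_add_one_sub_log_pos hN).ne', ENNReal.ofReal_one]

theorem ergodic_gaussT (hN : 0 < N) : Ergodic (gaussT N) (gaussMeasure N) where
  toMeasurePreserving := measurePreserving_gaussT hN
  aeconst_set _ hA hinv :=
    ((preErgodic_gaussT hN).aeconst_set hA hinv).anti
      (withDensity_absolutelyContinuous _ _).ae_le

theorem restrict_absolutelyContinuous_gaussMeasure (hN : 0 < N) :
    volume.restrict (Ico (0 : ℝ) 1) ≪ gaussMeasure N := by
  refine withDensity_absolutelyContinuous' measurable_gaussDensity.ennreal_ofReal.aemeasurable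
    ((ae_restrict_iff' measurableSet_Ico).2 (.of_forall fun x hx => ?_))
  exact (ENNReal.ofReal_pos.2 (gaussDensity_pos hN hx)).ne'

/-- The factors of the product defining `khinchinConst`. -/
noncomputable def khinchinFactor (N j : ℕ) : ℝ :=
  (((j : ℝ) + N + 1) ^ 2 / (((j : ℝ) + N) * ((j : ℝ) + N + 2))) ^
      (Real.log ((j : ℝ) + N) / (Real.log (N + 1) - Real.log N))

theorem khinchinFactor_pos (hN : 0 < N) (j : ℕ) : 0 < khinchinFactor N j :=
  Real.rpow_pos_of_pos (by positivity) _

theorem log_khinchinFactor (hN : 0 < N) (j : ℕ) :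
    Real.log (khinchinFactor N j) =
      (Real.log (j + N + 1) - Real.log (j + N) -
        (Real.log (j + N + 1 + 1) - Real.log (j + N + 1))) /
        (Real.log (N + 1) - Real.log N) * Real.log (j + N) := by
  have hN' : (0 : ℝ) < N := by exact_mod_cast hN
  rw [khinchinFactor, Real.log_rpow (by positivity), Real.log_div (by positivity) (by positivity),
    Real.log_pow, Real.log_mul (by positivity) (by positivity),
    show (j + N + 1 + 1 : ℝ) = j + N + 2 by ring]
  push_cast
  ring

theorem log_nat_add_nonneg (hN : 0 < N) (j : ℕ) : 0 ≤ Real.log ((j : ℝ) + N) := by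
  have hN' : (1 : ℝ) ≤ N := by exact_mod_cast hN
  exact Real.log_nonneg (by linarith [(j.cast_nonneg : (0 : ℝ) ≤ j)])

theorem log_khinchinFactor_nonneg (hN : 0 < N) (j : ℕ) : 0 ≤ Real.log (khinchinFactor N j) := by
  have hN' : (0 : ℝ) < N := by exact_mod_cast hN
  refine Real.log_nonneg (Real.one_le_rpow ?_
    (div_nonneg (log_nat_add_nonneg hN j) (log_add_one_sub_log_pos hN).le))
  rw [one_le_div (by positivity)]
  linarith

theorem summable_log_khinchinFactor (hN : 0 < N) :
    Summable fun j => Real.log (khinchinFactor N j) := by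
  have hN' : (0 : ℝ) < N := by exact_mod_cast hN
  have hL := log_add_one_sub_log_pos hN
  have h1 : Summable fun j : ℕ => ((j + N : ℕ) : ℝ) ^ (-(3 / 2) : ℝ) :=
    (summable_nat_add_iff N).2 (Real.summable_nat_rpow.2 (by norm_num))
  refine (h1.mul_left (2 / (Real.log (N + 1) - Real.log N))).of_nonneg_of_le
    (log_khinchinFactor_nonneg hN) fun j => ?_
  push_cast
  have hk : (0 : ℝ) < j + N := by positivity
  rw [khinchinFactor, Real.log_rpow (by positivity)]
  generalize (j + N : ℝ) = k at hk ⊢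
  have h2 : Real.log k ≤ 2 * k ^ (1 / 2 : ℝ) := by
    have := Real.log_le_rpow_div hk.le (ε := 1 / 2) (by norm_num)
    linarith
  have h3 : Real.log ((k + 1) ^ 2 / (k * (k + 2))) ≤ k ^ (-2 : ℝ) := by
    refine (Real.log_le_sub_one_of_pos (by positivity)).trans ?_
    rw [Real.rpow_neg hk.le, Real.rpow_two, div_sub_one (by positivity), ← one_div,
      div_le_div_iff₀ (by positivity) (by positivity)]
    nlinarith
  have h4 : 0 ≤ Real.log ((k + 1) ^ 2 / (k * (k + 2))) := by
    refine Real.log_nonneg ?_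
    rw [one_le_div (by positivity)]
    linarith
  rw [show (-(3 / 2) : ℝ) = 1 / 2 + -2 by norm_num, Real.rpow_add hk, div_mul_eq_mul_div,
    div_mul_eq_mul_div, ← mul_assoc]
  gcongr

theorem exp_tsum_log_khinchinFactor (hN : 0 < N) :
    Real.exp (∑' j, Real.log (khinchinFactor N j)) = khinchinConst N :=
  Real.rexp_tsum_eq_tprod (khinchinFactor_pos hN) (summable_log_khinchinFactor hN)

theorem measurable_log_coeff : Measurable fun x : ℝ => Real.log (⌊(N : ℝ) / x⌋ : ℝ) := by
  fun_prop

theorem lintegral_log_coeff (hN : 0 < N) :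
    ∫⁻ x, ENNReal.ofReal (Real.log (⌊(N : ℝ) / x⌋ : ℝ)) ∂gaussMeasure N =
      ENNReal.ofReal (∑' j, Real.log (khinchinFactor N j)) := by
  have hN' : (0 : ℝ) < N := by exact_mod_cast hN
  rw [lintegral_gaussMeasure_eq_tsum hN _ measurable_log_coeff.ennreal_ofReal,
    ENNReal.ofReal_tsum_of_nonneg (log_khinchinFactor_nonneg hN) (summable_log_khinchinFactor hN)]
  refine tsum_congr fun j => ?_
  obtain ⟨h1, h2⟩ := integrableOn_one_div_add_and_integral (c := j + N) (by positivity)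
  obtain ⟨h3, h4⟩ := integrableOn_one_div_add_and_integral (c := j + N + 1) (by positivity)
  have hL := log_add_one_sub_log_pos hN
  have h5 : ∀ x ∈ Ico (0 : ℝ) 1,
      ENNReal.ofReal ((1 / (j + N + x) - 1 / (j + N + 1 + x)) / (Real.log (N + 1) - Real.log N)) *
        ENNReal.ofReal (Real.log (⌊(N : ℝ) / (N / (j + N + x))⌋ : ℝ)) =
      ENNReal.ofReal ((1 / (j + N + x) - 1 / (j + N + 1 + x)) /
        (Real.log (N + 1) - Real.log N) * Real.log (j + N)) := fun x hx => by
    rw [floor_div_inverse_branch hN j hx, ENNReal.ofReal_mul' (log_nat_add_nonneg hN j)]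
    push_cast
    rfl
  rw [setLIntegral_congr_fun measurableSet_Ico h5, ← ofReal_integral_eq_lintegral_ofReal,
    log_khinchinFactor hN, integral_mul_const, integral_div, integral_sub h1 h3, h2, h4]
  · exact ((h1.sub h3).div_const _).mul_const _
  · refine (ae_restrict_iff' measurableSet_Ico).2 (.of_forall fun x hx => ?_)
    have hx0 := hx.1
    refine mul_nonneg (div_nonneg (sub_nonneg.2 ?_) hL.le) (log_nat_add_nonneg hN j)
    exact one_div_le_one_div_of_le (by positivity) (by linarith)

theorem integrable_log_coeff (hN : 0 < N) :
    Integrable (fun x : ℝ => Real.log (⌊(N : ℝ) / x⌋ : ℝ)) (gaussMeasure N) := by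
  refine (lintegral_ofReal_ne_top_iff_integrable measurable_log_coeff.aestronglyMeasurable
    (.of_forall fun x => Real.log_intCast_nonneg _)).1 ?_
  rw [lintegral_log_coeff hN]
  exact ENNReal.ofReal_ne_top

theorem exp_integral_log_coeff (hN : 0 < N) :
    Real.exp (∫ x, Real.log (⌊(N : ℝ) / x⌋ : ℝ) ∂gaussMeasure N) = khinchinConst N := by
  rw [integral_eq_lintegral_of_nonneg_ae (.of_forall fun x => Real.log_intCast_nonneg _)
    measurable_log_coeff.aestronglyMeasurable, lintegral_log_coeff hN,
    ENNReal.toReal_ofReal (tsum_nonneg (log_khinchinFactor_nonneg hN)),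
    exp_tsum_log_khinchinFactor hN]

theorem coeff_pos (hN : 0 < N) {y : ℝ} (hy : y ∈ Ioo (0 : ℝ) 1) : (0 : ℝ) < ⌊(N : ℝ) / y⌋ := by
  have hN' : (1 : ℝ) ≤ N := by exact_mod_cast hN
  have : 0 < ⌊(N : ℝ) / y⌋ := by
    rw [Int.floor_pos, le_div_iff₀ hy.1]
    linarith [hy.2]
  exact_mod_cast this

theorem ae_iterate_coeff_pos (hN : 0 < N) :
    ∀ᵐ x ∂gaussMeasure N, ∀ k : ℕ, (0 : ℝ) < ⌊(N : ℝ) / (gaussT N)^[k] x⌋ := by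
  have h0 : ∀ᵐ x ∂gaussMeasure N, x ∈ Ioo (0 : ℝ) 1 := by
    refine (withDensity_absolutelyContinuous _ _).ae_le ?_
    rw [← restrict_Ioo_eq_restrict_Ico]
    exact ae_restrict_mem measurableSet_Ioo
  refine ae_all_iff.2 fun k => ?_
  filter_upwards [((measurePreserving_gaussT hN).iterate k).quasiMeasurePreserving.ae h0]
    with x hx using coeff_pos hN hx

end GaussMap

/-- For Lebesgue almost every `x ∈ [0,1)`, the geometric mean of the `N`-continued
fraction coefficients `a_k = ⌊N / T_N^[k-1] x⌋` of `x` converges to `K_N`. -/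
theorem gaussT_coeff_geom_mean (N : ℕ) (hN : 0 < N) :
    ∀ᵐ x ∂(volume.restrict (Set.Ico (0:ℝ) 1)),
      Tendsto (fun n : ℕ =>
          (∏ k ∈ Finset.range n, (⌊(N : ℝ) / (gaussT N)^[k] x⌋ : ℝ)) ^ (1 / (n : ℝ)))
        atTop (nhds (khinchinConst N)) := by
  have := isProbabilityMeasure_gaussMeasure hN
  refine (restrict_absolutelyContinuous_gaussMeasure hN).ae_le ?_
  filter_upwards [(ergodic_gaussT hN).ae_tendsto_birkhoffAverage measurable_log_coeff
    (integrable_log_coeff hN), ae_iterate_coeff_pos hN] with x hx hpos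
  rw [← exp_integral_log_coeff hN]
  refine ((Real.continuous_exp.tendsto _).comp hx).congr fun n => ?_
  rw [Function.comp_apply, birkhoffAverage, birkhoffSum, smul_eq_mul,
    ← Real.log_prod fun k _ => (hpos k).ne', mul_comm, ← one_div,
    Real.rpow_def_of_pos (Finset.prod_pos fun k _ => hpos k)]
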